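/- Aldous–Hoover Theorem (strong form): let X be a standard Borel space, let p be a row-column exchangeable probability measure on ℕ × ℕ → X, and fix n ∈ ℕ. Consider the reorganization map Φₙ sending an array x : ℕ × ℕ → X to the quadruple consisting of: the core block (x(i,j))_{i,j < n}; the row tails r_i = (x(i, n+k))_{k∈ℕ} for i < n; the column tails c_j = (x(n+k, j))_{k∈ℕ} for j < n; and the tail array t = (x(n+k, n+l))_{(k,l)∈ℕ×ℕ}. Then there exist Markov kernels f, g : (ℕ × ℕ → X) → (ℕ → X) and h : (ℕ → X) × (ℕ × ℕ → X) × (ℕ → X) → X such that the pushforward of p under Φₙ equals the law of the quadruple generated as follows: sample t ∼ p; sample r_i ∼ f(t) independently for i < n and c_j ∼ g(t) independently for j < n; then, conditionally independently over all pairs (i,j) with i, j < n, sample the core entry at (i,j) from h(r_i, t, c_j); and output ((core entries), (r_i)_{i<n}, (c_j)_{j<n}, t). -/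

import Mathlib

open MeasureTheory ProbabilityTheory

/-- A measure on `ℕ × ℕ → X` is row-column exchangeable if for every permutation `σ` of `ℕ`
fixing all but finitely many elements, it is invariant under permuting the rows by `σ` and
under permuting the columns by `σ`. -/
def RowColumnExchangeable {X : Type*} [MeasurableSpace X]
    (p : Measure (ℕ × ℕ → X)) : Prop :=
  ∀ σ : Equiv.Perm ℕ, {n | σ n ≠ n}.Finite →
    p.map (fun x (ij : ℕ × ℕ) => x (σ ij.1, ij.2)) = p ∧
    p.map (fun x (ij : ℕ × ℕ) => x (ij.1, σ ij.2)) = p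

/-- The reorganization map `Φₙ` sending an array `x : ℕ × ℕ → X` to the quadruple
consisting of the core block `(x (i, j))_{i,j < n}`, the row tails
`r i = (x (i, n + k))_k` for `i < n`, the column tails `c j = (x (n + k, j))_k` for
`j < n`, and the tail array `t = (x (n + k, n + l))_{(k,l)}`. -/
def reorganize {X : Type*} (n : ℕ) (x : ℕ × ℕ → X) :
    (Fin n × Fin n → X) × (Fin n → ℕ → X) × (Fin n → ℕ → X) × (ℕ × ℕ → X) :=
  ((fun ij : Fin n × Fin n => x (ij.1, ij.2)),
   (fun (i : Fin n) (k : ℕ) => x (i, n + k)),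
   (fun (j : Fin n) (k : ℕ) => x (n + k, j)),
   (fun kl : ℕ × ℕ => x (n + kl.1, n + kl.2)))

open scoped ENNReal

/-- If `T` preserves `μ` and `f`, and pulls `mW` back into the smaller σ-algebra `mV`, then
conditioning `f` on `mW` is the same as conditioning on `mV`. -/
theorem condExp_ae_eq_of_measurePreserving {Ω : Type*} {mV mW m0 : MeasurableSpace Ω}
    {μ : Measure[m0] Ω} [IsFiniteMeasure μ] (hVW : mV ≤ mW) (hW : mW ≤ m0) {T : Ω → Ω}
    (hT : MeasurePreserving T μ μ) (hTm : Measurable[mV, mW] T) {f : Ω → ℝ}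
    (hf : MemLp f 2 μ) (hfT : f ∘ T = f) :
    μ[f|mW] =ᵐ[μ] μ[f|mV] := by
  have integral_mul_condExp : ∀ m : MeasurableSpace Ω, m ≤ m0 → ∀ g : Ω → ℝ,
      StronglyMeasurable[m] g → MemLp g 2 μ → ∫ x, f x * g x ∂μ = ∫ x, (μ[f|m]) x * g x ∂μ := by
    intro m hm g hg hg2
    rw [← integral_condExp hm]
    exact integral_congr_ae (condExp_mul_of_stronglyMeasurable_right hg
      (hf.integrable_mul hg2) (hf.integrable one_le_two))
  set k := μ[f|mW] with hk
  set e := μ[f|mV] with he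
  have hk2 : MemLp k 2 μ := hf.condExp one_le_two
  have he2 : MemLp e 2 μ := hf.condExp one_le_two
  have hkT2 : MemLp (k ∘ T) 2 μ := hk2.comp_measurePreserving hT
  have hkm : StronglyMeasurable[mW] k := stronglyMeasurable_condExp
  have hem : StronglyMeasurable[mV] e := stronglyMeasurable_condExp
  have hkTm : StronglyMeasurable[mV] (k ∘ T) := hkm.comp_measurable hTm
  have comp_eq : ∀ g : Ω → ℝ, MemLp g 1 μ → ∫ x, g (T x) ∂μ = ∫ x, g x ∂μ := by
    intro g hg
    rw [← integral_map hT.measurable.aemeasurable (by rw [hT.map_eq]; exact hg.1), hT.map_eq]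
  have hmul : ∀ {u v : Ω → ℝ}, MemLp u 2 μ → MemLp v 2 μ →
      Integrable (fun x => u x * v x) μ := fun hu hv => hu.integrable_mul hv
  have hkk := integral_mul_condExp mW hW k hkm hk2
  have hke := integral_mul_condExp mW hW e (hem.mono hVW) he2
  have hee := integral_mul_condExp mV (hVW.trans hW) e hem he2
  have hekT := integral_mul_condExp mV (hVW.trans hW) (k ∘ T) hkTm hkT2
  have hfkT : ∫ x, f x * (k ∘ T) x ∂μ = ∫ x, f x * k x ∂μ := by
    rw [← comp_eq _ (memLp_one_iff_integrable.2 (hmul hf hk2))]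
    refine integral_congr_ae (.of_forall fun x => ?_)
    simp [← congrFun hfT x]
  have hkTkT : ∫ x, (k ∘ T) x * (k ∘ T) x ∂μ = ∫ x, k x * k x ∂μ :=
    comp_eq _ (memLp_one_iff_integrable.2 (hmul hk2 hk2))
  have expand : ∀ {u v : Ω → ℝ}, MemLp u 2 μ → MemLp v 2 μ →
      ∫ x, (u x - v x) ^ 2 ∂μ
        = ∫ x, u x * u x ∂μ - 2 * ∫ x, u x * v x ∂μ + ∫ x, v x * v x ∂μ := by
    intro u v hu hv
    rw [← integral_const_mul, ← integral_sub (hmul hu hu) ((hmul hu hv).const_mul 2)]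
    refine Eq.trans (integral_congr_ae (.of_forall fun x => ?_))
      (integral_add ((hmul hu hu).sub ((hmul hu hv).const_mul 2)) (hmul hv hv))
    ring
  have h1 : 0 ≤ ∫ x, (e x - (k ∘ T) x) ^ 2 ∂μ := integral_nonneg fun x => sq_nonneg _
  have h2 : 0 ≤ ∫ x, (k x - e x) ^ 2 ∂μ := integral_nonneg fun x => sq_nonneg _
  have h3 : ∫ x, (k x - e x) ^ 2 ∂μ = 0 := by
    rw [expand he2 hkT2] at h1
    rw [expand hk2 he2] at h2 ⊢
    linarith
  have h3 := (integral_eq_zero_iff_of_nonneg (fun x => sq_nonneg _)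
    (hk2.sub he2).integrable_sq).1 h3
  filter_upwards [h3] with x hx
  exact sub_eq_zero.1 (pow_eq_zero_iff two_ne_zero |>.1 hx)

/-- Disintegrating a random variable `Y` along `Z` also disintegrates it along a larger σ-algebra
`mW`, provided the events of a generating π-system are invariant under measure-preserving
maps pulling `mW` back into the σ-algebra of `Z`. -/
theorem measure_preimage_inter_eq_setLIntegral {Ω E F : Type*} {mW m0 : MeasurableSpace Ω}
    [MeasurableSpace E] [mF : MeasurableSpace F] {μ : Measure[m0] Ω} [IsProbabilityMeasure μ]
    (hW : mW ≤ m0) {Y : Ω → F} (hY : Measurable Y) {Z : Ω → E} (hZ : Measurable[mW] Z)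
    {κ : Kernel E F} [IsMarkovKernel κ]
    (hκ : μ.map (fun ω => (Z ω, Y ω)) = μ.map Z ⊗ₘ κ)
    {C : Set (Set F)} (hC : IsPiSystem C) (hgen : mF = .generateFrom C)
    (hinv : ∀ A ∈ C, ∃ T : Ω → Ω, MeasurePreserving T μ μ ∧
      Measurable[MeasurableSpace.comap Z inferInstance, mW] T ∧ T ⁻¹' (Y ⁻¹' A) = Y ⁻¹' A)
    {A : Set F} (hA : MeasurableSet A) {S : Set Ω} (hS : MeasurableSet[mW] S) :
    μ (Y ⁻¹' A ∩ S) = ∫⁻ ω in S, κ (Z ω) A ∂μ := by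
  have hZ0 : Measurable[m0] Z := hZ.mono hW le_rfl
  have hVW : MeasurableSpace.comap Z inferInstance ≤ mW := hZ.comap_le
  have hκZ : ∀ A, MeasurableSet A → Measurable[m0] fun ω => κ (Z ω) A := fun A hA =>
    (κ.measurable_coe hA).comp hZ0
  have hV : ∀ A, MeasurableSet A → ∀ B, MeasurableSet B →
      μ (Y ⁻¹' A ∩ Z ⁻¹' B) = ∫⁻ ω in Z ⁻¹' B, κ (Z ω) A ∂μ := by
    intro A hA B hB
    have := congrArg (fun ν => ν (B ×ˢ A)) hκ
    rw [Measure.map_apply (hZ0.prodMk hY) (hB.prod hA), Measure.compProd_apply_prod hB hA,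
      setLIntegral_map hB (κ.measurable_coe hA) hZ0] at this
    rw [← this]
    congr 1
    ext ω
    simp [and_comm]
  have hCm : ∀ A ∈ C, MeasurableSet A := fun A hA => by
    rw [hgen]; exact .basic A hA
  have key : ∀ A ∈ C, μ (Y ⁻¹' A ∩ S) = ∫⁻ ω in S, κ (Z ω) A ∂μ := by
    intro A hAC
    have hA := hCm A hAC
    obtain ⟨T, hT, hTm, hTA⟩ := hinv A hAC
    set f : Ω → ℝ := (Y ⁻¹' A).indicator fun _ => 1 with hf
    have hf2 : MemLp f 2 μ := memLp_indicator_const 2 (hY hA) 1 (.inr (measure_ne_top _ _))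
    have hfT : f ∘ T = f := by
      ext ω
      have : T ω ∈ Y ⁻¹' A ↔ ω ∈ Y ⁻¹' A := by
        conv_rhs => rw [← hTA]
        rfl
      classical
      simp only [hf, Function.comp, Set.indicator_apply, this]
    have hint : ∀ B : Set Ω, Integrable (fun ω => (κ (Z ω)).real A) (μ.restrict B) := fun B =>
      Integrable.of_bound (hκZ A hA).ennreal_toReal.aestronglyMeasurable 1
        (.of_forall fun ω => by
          rw [Real.norm_of_nonneg measureReal_nonneg]; exact measureReal_le_one)
    have setInt : ∀ B : Set Ω, ENNReal.ofReal (∫ ω in B, (κ (Z ω)).real A ∂μ)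
        = ∫⁻ ω in B, κ (Z ω) A ∂μ := by
      intro B
      rw [ofReal_integral_eq_lintegral_ofReal (hint B) (.of_forall fun _ => measureReal_nonneg)]
      simp
    have setIntf : ∀ B : Set Ω, ENNReal.ofReal (∫ ω in B, f ω ∂μ) = μ (Y ⁻¹' A ∩ B) := by
      intro B
      rw [hf, integral_indicator_const _ (hY hA)]
      simp [Measure.real, Measure.restrict_apply (hY hA)]
    have hkV : (fun ω => (κ (Z ω)).real A) =ᵐ[μ]
        μ[f|MeasurableSpace.comap Z inferInstance] := by
      refine ae_eq_condExp_of_forall_setIntegral_eq (hVW.trans hW)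
        (hf2.integrable one_le_two) (fun B _ _ => hint B) ?_ ?_
      · rintro _ ⟨B, hB, rfl⟩ -
        have h := hV A hA B hB
        rw [← setInt, ← setIntf, ENNReal.ofReal_eq_ofReal_iff] at h
        · exact h.symm
        · exact integral_nonneg fun ω => Set.indicator_nonneg (by simp) _
        · exact integral_nonneg fun ω => measureReal_nonneg
      · exact (((κ.measurable_coe hA).comp
          (comap_measurable Z)).ennreal_toReal.stronglyMeasurable).aestronglyMeasurable
    have hkW := condExp_ae_eq_of_measurePreserving hVW hW hT hTm hf2 hfT
    rw [← setInt, ← setIntf, ← setIntegral_condExp hW (hf2.integrable one_le_two) hS]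
    congr 1
    exact integral_congr_ae (ae_restrict_of_ae (hkW.trans hkV.symm))
  have hS0 := hW S hS
  have hκZm : Measurable[m0] fun ω => κ (Z ω) := κ.measurable.comp hZ0
  have hbind : ∀ A, MeasurableSet A → ((μ.restrict S).bind fun ω => κ (Z ω)) A
      = ∫⁻ ω in S, κ (Z ω) A ∂μ := fun A hA => Measure.bind_apply hA hκZm.aemeasurable
  have hmap : ∀ A, MeasurableSet A → (μ.restrict S).map Y A = μ (Y ⁻¹' A ∩ S) := fun A hA => by
    rw [Measure.map_apply hY hA, Measure.restrict_apply (hY hA)]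
  have heq : (μ.restrict S).map Y = (μ.restrict S).bind fun ω => κ (Z ω) := by
    refine ext_of_generate_finite C hgen hC (fun A hA => ?_) ?_
    · rw [hbind A (hCm A hA), hmap A (hCm A hA), key A hA]
    · rw [hbind _ .univ, hmap _ .univ]
      simp
  rw [← hmap A hA, heq, hbind A hA]

/-- The product of finitely many Markov kernels with a common source. -/
noncomputable def piKernel {E F ι : Type*} [Fintype ι] [MeasurableSpace E] [MeasurableSpace F]
    (κ : ι → Kernel E F) [∀ a, IsMarkovKernel (κ a)] : Kernel E (ι → F) where
  toFun z := Measure.pi fun a => κ a z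
  measurable' := by
    refine Measurable.measure_of_isPiSystem_of_isProbabilityMeasure generateFrom_pi.symm
      isPiSystem_pi ?_
    rintro _ ⟨A, hA, rfl⟩
    simp only [Measure.pi_pi]
    exact Finset.measurable_fun_prod _ fun a _ => (κ a).measurable_coe (hA a trivial)

@[simp]
theorem piKernel_apply {E F ι : Type*} [Fintype ι] [MeasurableSpace E] [MeasurableSpace F]
    (κ : ι → Kernel E F) [∀ a, IsMarkovKernel (κ a)] (z : E) :
    piKernel κ z = Measure.pi fun a => κ a z := rfl

instance {E F ι : Type*} [Fintype ι] [MeasurableSpace E] [MeasurableSpace F]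
    (κ : ι → Kernel E F) [∀ a, IsMarkovKernel (κ a)] : IsMarkovKernel (piKernel κ) :=
  ⟨fun z => by rw [piKernel_apply]; infer_instance⟩

theorem lintegral_indicator_mul_eq_of_measure_inter_eq {Ω : Type*} {m m0 : MeasurableSpace Ω}
    {μ : Measure[m0] Ω} (hm : m ≤ m0) {A : Set Ω} (hA : MeasurableSet[m0] A)
    {w : Ω → ℝ≥0∞} (hw : Measurable[m0] w)
    (h : ∀ S, MeasurableSet[m] S → μ (A ∩ S) = ∫⁻ ω in S, w ω ∂μ)
    {G : Ω → ℝ≥0∞} (hG : Measurable[m] G) :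
    ∫⁻ ω, A.indicator 1 ω * G ω ∂μ = ∫⁻ ω, w ω * G ω ∂μ := by
  have htrim : (μ.withDensity (A.indicator 1)).trim hm = (μ.withDensity w).trim hm := by
    refine @Measure.ext _ m _ _ fun S hS => ?_
    rw [trim_measurableSet_eq hm hS, trim_measurableSet_eq hm hS,
      withDensity_apply _ (hm S hS), withDensity_apply _ (hm S hS), ← h S hS,
      lintegral_indicator_one hA, Measure.restrict_apply hA]
  have hG0 : Measurable[m0] G := hG.mono hm le_rfl
  have hA1 : Measurable[m0] (A.indicator (1 : Ω → ℝ≥0∞)) := measurable_one.indicator hA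
  calc ∫⁻ ω, A.indicator 1 ω * G ω ∂μ
      = ∫⁻ ω, G ω ∂(μ.withDensity (A.indicator 1)) :=
        (lintegral_withDensity_eq_lintegral_mul μ hA1 hG0).symm
    _ = ∫⁻ ω, G ω ∂(μ.withDensity w) := by
        rw [← lintegral_trim hm hG, htrim, lintegral_trim hm hG]
    _ = ∫⁻ ω, w ω * G ω ∂μ := lintegral_withDensity_eq_lintegral_mul μ hw hG0

/-- If each `Y a` has conditional law `κ a (Z ·)` given a σ-algebra which contains `Z` and all the
other `Y b`, then the `Y a` are conditionally independent given `Z` with laws `κ a (Z ·)`. -/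
theorem lintegral_eq_lintegral_piKernel {Ω E F ι : Type*} [Fintype ι] {m0 : MeasurableSpace Ω}
    [MeasurableSpace E] [MeasurableSpace F] {μ : Measure Ω} [IsProbabilityMeasure μ]
    {mW : ι → MeasurableSpace Ω} (hW : ∀ a, mW a ≤ m0) {Z : Ω → E} {Y : ι → Ω → F}
    (hZ : Measurable Z) (hY : ∀ a, Measurable (Y a)) (hZW : ∀ a, Measurable[mW a] Z)
    (hYW : ∀ a b, b ≠ a → Measurable[mW a] (Y b))
    (κ : ι → Kernel E F) [∀ a, IsMarkovKernel (κ a)]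
    (h : ∀ a A, MeasurableSet A → ∀ S, MeasurableSet[mW a] S →
      μ (Y a ⁻¹' A ∩ S) = ∫⁻ ω in S, κ a (Z ω) A ∂μ)
    {G : E × (ι → F) → ℝ≥0∞} (hG : Measurable G) :
    ∫⁻ ω, G (Z ω, fun a => Y a ω) ∂μ = ∫⁻ ω, ∫⁻ y, G (Z ω, y) ∂(piKernel κ (Z ω)) ∂μ := by
  classical
  have hYp : Measurable fun ω => fun a => Y a ω := measurable_pi_lambda _ hY
  have key : ∀ A : ι → Set F, (∀ a, MeasurableSet (A a)) → ∀ s : Finset ι,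
      ∀ g : E → ℝ≥0∞, Measurable g →
      ∫⁻ ω, (∏ a ∈ s, (Y a ⁻¹' A a).indicator 1 ω) * g (Z ω) ∂μ
        = ∫⁻ ω, (∏ a ∈ s, κ a (Z ω) (A a)) * g (Z ω) ∂μ := by
    intro A hA s
    induction s using Finset.induction_on with
    | empty => intro g _; simp
    | insert a s ha ih =>
      intro g hg
      have hκA : Measurable fun z => κ a z (A a) := (κ a).measurable_coe (hA a)
      simp only [Finset.prod_insert ha, mul_assoc]
      rw [lintegral_indicator_mul_eq_of_measure_inter_eq (hW a) (hY a (hA a)) (hκA.comp hZ)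
        (h a (A a) (hA a))]
      · have := ih (fun z => κ a z (A a) * g z) (hκA.mul hg)
        simp only [mul_left_comm] at this ⊢
        exact this
      · refine Measurable.mul ?_ (hg.comp (hZW a))
        refine Finset.measurable_fun_prod _ fun b hb => ?_
        exact (measurable_one.indicator (hA b) : Measurable ((A b).indicator 1)).comp
          (hYW a b (by rintro rfl; exact ha hb))
  have hmeas : μ.map (fun ω => (Z ω, fun a => Y a ω)) = μ.map Z ⊗ₘ piKernel κ := by
    have : IsProbabilityMeasure (μ.map Z) := Measure.isProbabilityMeasure_map hZ.aemeasurable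
    have : IsProbabilityMeasure (μ.map fun ω => (Z ω, fun a => Y a ω)) :=
      Measure.isProbabilityMeasure_map (hZ.prodMk hYp).aemeasurable
    refine ext_of_generate_finite _ (generateFrom_eq_prod (C := {s : Set E | MeasurableSet s})
      MeasurableSpace.generateFrom_measurableSet generateFrom_pi
      isCountablySpanning_measurableSet ?_).symm
      (MeasurableSpace.isPiSystem_measurableSet.prod isPiSystem_pi) ?_ (by simp)
    · exact ⟨fun _ => Set.univ, fun _ => ⟨fun _ => Set.univ, by simp, by simp⟩, Set.iUnion_const _⟩
    · rintro _ ⟨B, hB, _, ⟨A, hA, rfl⟩, rfl⟩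
      have hA' : ∀ a, MeasurableSet (A a) := fun a => hA a trivial
      have hB' : MeasurableSet B := hB
      have hP : MeasurableSet (Set.univ.pi A) := .univ_pi hA'
      have hk := key A hA' Finset.univ (B.indicator 1) (measurable_one.indicator hB')
      rw [Measure.map_apply (hZ.prodMk hYp) (hB'.prod hP), Measure.compProd_apply_prod hB' hP,
        setLIntegral_map hB' ((piKernel κ).measurable_coe hP) hZ,
        ← lintegral_indicator_one ((hZ.prodMk hYp) (hB'.prod hP)),
        ← lintegral_indicator (hZ hB')]
      refine Eq.trans (lintegral_congr fun ω => ?_) (hk.trans (lintegral_congr fun ω => ?_))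
      · by_cases h1 : Z ω ∈ B
        · by_cases h2 : ∀ a, Y a ω ∈ A a
          · simp [h1, h2]
          · have h3 := h2
            push Not at h3
            obtain ⟨a, ha⟩ := h3
            rw [Finset.prod_eq_zero (Finset.mem_univ a) (by simp [ha])]
            simp [Set.indicator_apply, h2]
        · simp [Set.indicator_apply, h1]
      · by_cases h1 : Z ω ∈ B <;> simp [h1, Measure.pi_pi]
  calc ∫⁻ ω, G (Z ω, fun a => Y a ω) ∂μ
      = ∫⁻ q, G q ∂(μ.map Z ⊗ₘ piKernel κ) := by
        rw [← hmeas, lintegral_map hG (hZ.prodMk hYp)]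
    _ = ∫⁻ ω, ∫⁻ y, G (Z ω, y) ∂(piKernel κ (Z ω)) ∂μ := by
        have : IsProbabilityMeasure (μ.map Z) := Measure.isProbabilityMeasure_map hZ.aemeasurable
        rw [Measure.lintegral_compProd hG, lintegral_map hG.lintegral_kernel_prod_right' hZ]

section Arrays

variable {X : Type*} [MeasurableSpace X]

theorem exists_perm_eqOn_finset {σ : ℕ → ℕ} (hσ : σ.Injective) (s : Finset ℕ) :
    ∃ e : Equiv.Perm ℕ, {k | e k ≠ k}.Finite ∧ ∀ k ∈ s, e k = σ k := by
  classical
  set u : Finset ℕ := s ∪ s.image σ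
  obtain ⟨g, hg⟩ : ∃ g : u ≃ u, ∀ k ∈ s.subtype (· ∈ u), (g k : ℕ) = σ k := by
    refine Finset.exists_equiv_extend_of_card_eq (f := fun k : u => σ k) (by simp) ?_
      fun a _ b _ hab => Subtype.ext (hσ hab)
    intro k hk
    obtain ⟨a, ha, rfl⟩ := Finset.mem_image.1 hk
    exact Finset.mem_union_right _ (Finset.mem_image_of_mem _ (Finset.mem_subtype.1 ha))
  refine ⟨Equiv.Perm.ofSubtype (p := (· ∈ u)) g, u.finite_toSet.subset fun k hk => ?_,
    fun k hk => ?_⟩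
  · by_contra hku
    exact hk (Equiv.Perm.ofSubtype_apply_of_not_mem g hku)
  · have hku : k ∈ u := Finset.mem_union_left _ hk
    rw [Equiv.Perm.ofSubtype_apply_of_mem g hku]
    exact hg ⟨k, hku⟩ (Finset.mem_subtype.2 hk)

theorem exists_injective_eq_self_or_ge (s : Finset ℕ) (n : ℕ) :
    ∃ σ : ℕ → ℕ, σ.Injective ∧ (∀ k ∈ s, σ k = k) ∧ ∀ k ∉ s, n ≤ σ k := by
  refine ⟨fun k => if k ∈ s then k else k + (n + s.sup id + 1), fun a b hab => ?_,
    fun k hk => if_pos hk, fun k hk => by simp only [if_neg hk]; omega⟩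
  have hle : ∀ k ∈ s, k ≤ s.sup id := fun k hk => Finset.le_sup (f := id) hk
  have ha := hle a
  have hb := hle b
  simp only at hab
  split_ifs at hab with h1 h2 h2
  · exact hab
  · have := ha h1; omega
  · have := hb h2; omega
  · omega

theorem measurable_reindex (σ τ : ℕ → ℕ) :
    Measurable fun (x : ℕ × ℕ → X) (q : ℕ × ℕ) => x (σ q.1, τ q.2) :=
  measurable_pi_lambda _ fun _ => measurable_pi_apply _

/-- Row-column exchangeability extends from finitely supported permutations to injections. -/
theorem RowColumnExchangeable.measurePreserving_reindex {p : Measure (ℕ × ℕ → X)}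
    [IsProbabilityMeasure p] (hp : RowColumnExchangeable p) {σ τ : ℕ → ℕ}
    (hσ : σ.Injective) (hτ : τ.Injective) :
    MeasurePreserving (fun (x : ℕ × ℕ → X) (q : ℕ × ℕ) => x (σ q.1, τ q.2)) p p := by
  refine ⟨measurable_reindex σ τ, ?_⟩
  refine IsProjectiveLimit.unique (P := fun I => p.map I.restrict) (fun I => ?_) fun I => rfl
  obtain ⟨e, he, heσ⟩ := exists_perm_eqOn_finset hσ (I.image Prod.fst)
  obtain ⟨e', he', heτ⟩ := exists_perm_eqOn_finset hτ (I.image Prod.snd)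
  have hperm : p.map (fun x (q : ℕ × ℕ) => x (e q.1, e' q.2)) = p := by
    conv_rhs => rw [← (hp e' he').2, ← (hp e he).1]
    exact (Measure.map_map (measurable_reindex id e') (measurable_reindex e id)).symm
  change _ = p.map I.restrict
  conv_rhs => rw [← hperm]
  rw [Measure.map_map (Finset.measurable_restrict I) (measurable_reindex _ _),
    Measure.map_map (Finset.measurable_restrict I) (measurable_reindex _ _)]
  congr 1
  ext x q
  simp only [Function.comp, Finset.restrict]
  rw [heσ _ (Finset.mem_image_of_mem _ q.2), heτ _ (Finset.mem_image_of_mem _ q.2)]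

/-- The σ-algebra on arrays generated by the entries with index in `Q`. -/
@[reducible]
def entryAlgebra (X : Type*) [MeasurableSpace X] (Q : Set (ℕ × ℕ)) :
    MeasurableSpace (ℕ × ℕ → X) :=
  MeasurableSpace.comap (fun x (q : Q) => x q) inferInstance

theorem entryAlgebra_le (Q : Set (ℕ × ℕ)) : entryAlgebra X Q ≤ MeasurableSpace.pi :=
  Measurable.comap_le (measurable_pi_lambda _ fun _ => measurable_pi_apply _)

theorem measurable_entry {Q : Set (ℕ × ℕ)} {q : ℕ × ℕ} (hq : q ∈ Q) :
    Measurable[entryAlgebra X Q] fun x : ℕ × ℕ → X => x q :=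
  (measurable_pi_apply (⟨q, hq⟩ : Q)).comp (comap_measurable fun (x : ℕ × ℕ → X) (q : Q) => x q)

theorem measurable_to_entryAlgebra {Ω : Type*} {m : MeasurableSpace Ω} {Q : Set (ℕ × ℕ)}
    {T : Ω → ℕ × ℕ → X} (hT : ∀ q ∈ Q, Measurable fun ω => T ω q) :
    Measurable[m, entryAlgebra X Q] T :=
  measurable_comap_iff.2 (measurable_pi_lambda _ fun q => hT q q.2)

/-- The part of row `i` beyond column `n`. -/
def rowTail (n i : ℕ) (x : ℕ × ℕ → X) (k : ℕ) : X := x (i, n + k)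

/-- The part of column `j` beyond row `n`. -/
def colTail (n j : ℕ) (x : ℕ × ℕ → X) (k : ℕ) : X := x (n + k, j)

/-- The part of the array beyond row and column `n`. -/
def tailArray (n : ℕ) (x : ℕ × ℕ → X) (q : ℕ × ℕ) : X := x (n + q.1, n + q.2)

theorem measurable_rowTail_entryAlgebra {n i : ℕ} {Q : Set (ℕ × ℕ)}
    (hQ : ∀ k, (i, n + k) ∈ Q) : Measurable[entryAlgebra X Q] (rowTail (X := X) n i) :=
  @measurable_pi_lambda _ _ _ (entryAlgebra X Q) _ _ fun k => measurable_entry (hQ k)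

theorem measurable_colTail_entryAlgebra {n j : ℕ} {Q : Set (ℕ × ℕ)}
    (hQ : ∀ k, (n + k, j) ∈ Q) : Measurable[entryAlgebra X Q] (colTail (X := X) n j) :=
  @measurable_pi_lambda _ _ _ (entryAlgebra X Q) _ _ fun k => measurable_entry (hQ k)

theorem measurable_tailArray_entryAlgebra {n : ℕ} {Q : Set (ℕ × ℕ)}
    (hQ : ∀ k l, (n + k, n + l) ∈ Q) :
    Measurable[entryAlgebra X Q, MeasurableSpace.pi] (tailArray (X := X) n) :=
  @measurable_pi_lambda _ _ _ (entryAlgebra X Q) _ _ fun q => measurable_entry (hQ q.1 q.2)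

@[fun_prop]
theorem measurable_rowTail (n i : ℕ) : Measurable (rowTail (X := X) n i) :=
  measurable_pi_lambda _ fun _ => measurable_pi_apply _

@[fun_prop]
theorem measurable_colTail (n j : ℕ) : Measurable (colTail (X := X) n j) :=
  measurable_pi_lambda _ fun _ => measurable_pi_apply _

@[fun_prop]
theorem measurable_tailArray (n : ℕ) : Measurable (tailArray (X := X) n) :=
  measurable_pi_lambda _ fun _ => measurable_pi_apply _

theorem measurable_entry_of_rowTail {m : MeasurableSpace (ℕ × ℕ → X)} {n i : ℕ}
    (h : Measurable[m] (rowTail (X := X) n i)) {b : ℕ} (hb : n ≤ b) :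
    Measurable[m] fun x : ℕ × ℕ → X => x (i, b) := by
  have := (measurable_pi_apply (b - n)).comp h
  simpa only [Function.comp_def, rowTail, Nat.add_sub_cancel' hb] using this

theorem measurable_entry_of_colTail {m : MeasurableSpace (ℕ × ℕ → X)} {n j : ℕ}
    (h : Measurable[m] (colTail (X := X) n j)) {a : ℕ} (ha : n ≤ a) :
    Measurable[m] fun x : ℕ × ℕ → X => x (a, j) := by
  have := (measurable_pi_apply (a - n)).comp h
  simpa only [Function.comp_def, colTail, Nat.add_sub_cancel' ha] using this

theorem measurable_entry_of_tailArray {m : MeasurableSpace (ℕ × ℕ → X)} {n : ℕ}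
    (h : Measurable[m, MeasurableSpace.pi] (tailArray (X := X) n)) {a b : ℕ} (ha : n ≤ a)
    (hb : n ≤ b) :
    Measurable[m] fun x : ℕ × ℕ → X => x (a, b) := by
  have := (measurable_pi_apply (a - n, b - n)).comp h
  simpa only [Function.comp_def, tailArray, Nat.add_sub_cancel' ha, Nat.add_sub_cancel' hb]
    using this

namespace RowColumnExchangeable

variable {p : Measure (ℕ × ℕ → X)} [IsProbabilityMeasure p]

theorem map_tailArray_rowTail (hp : RowColumnExchangeable p) {n i : ℕ} (hi : i < n) :
    p.map (fun x => (tailArray n x, rowTail n i x))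
      = p.map (fun x => (tailArray n x, rowTail n 0 x)) := by
  conv_rhs => rw [← (hp.measurePreserving_reindex (Equiv.swap 0 i).injective
    Function.injective_id).map_eq]
  rw [Measure.map_map (by fun_prop) (measurable_reindex _ _)]
  congr 1
  ext x q
  · simp [tailArray, Equiv.swap_apply_of_ne_of_ne (show n + q.1 ≠ 0 by omega)
      (show n + q.1 ≠ i by omega)]
  · simp [rowTail]

theorem map_tailArray_colTail (hp : RowColumnExchangeable p) {n j : ℕ} (hj : j < n) :
    p.map (fun x => (tailArray n x, colTail n j x))
      = p.map (fun x => (tailArray n x, colTail n 0 x)) := by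
  conv_rhs => rw [← (hp.measurePreserving_reindex Function.injective_id
    (Equiv.swap 0 j).injective).map_eq]
  rw [Measure.map_map (by fun_prop) (measurable_reindex _ _)]
  congr 1
  ext x q
  · simp [tailArray, Equiv.swap_apply_of_ne_of_ne (show n + q.2 ≠ 0 by omega)
      (show n + q.2 ≠ j by omega)]
  · simp [colTail]

theorem map_tails_entry (hp : RowColumnExchangeable p) {n i j : ℕ} (hi : i < n) (hj : j < n) :
    p.map (fun x => ((rowTail n i x, tailArray n x, colTail n j x), x (i, j)))
      = p.map (fun x => ((rowTail n 0 x, tailArray n x, colTail n 0 x), x (0, 0))) := by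
  conv_rhs => rw [← (hp.measurePreserving_reindex (Equiv.swap 0 i).injective
    (Equiv.swap 0 j).injective).map_eq]
  rw [Measure.map_map (by fun_prop) (measurable_reindex _ _)]
  have hi' : ∀ k, Equiv.swap 0 i (n + k) = n + k := fun k =>
    Equiv.swap_apply_of_ne_of_ne (by omega) (by omega)
  have hj' : ∀ k, Equiv.swap 0 j (n + k) = n + k := fun k =>
    Equiv.swap_apply_of_ne_of_ne (by omega) (by omega)
  congr 1
  funext x
  simp [tailArray, colTail, rowTail, hi', hj', funext_iff]

theorem measurePreserving_tailArray (hp : RowColumnExchangeable p) (n : ℕ) :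
    MeasurePreserving (tailArray n) p p :=
  hp.measurePreserving_reindex (add_right_injective n) (add_right_injective n)

/-- The tail of row `i` depends on all other rows only through the tail array. -/
theorem measure_rowTail_preimage_inter (hp : RowColumnExchangeable p) {n i : ℕ}
    {f : Kernel (ℕ × ℕ → X) (ℕ → X)} [IsMarkovKernel f]
    (hf : p.map (fun x => (tailArray n x, rowTail n i x)) = p.map (tailArray n) ⊗ₘ f)
    (hi : i < n) {A : Set (ℕ → X)} (hA : MeasurableSet A) {S : Set (ℕ × ℕ → X)}
    (hS : MeasurableSet[entryAlgebra X {q | q.1 ≠ i}] S) :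
    p (rowTail n i ⁻¹' A ∩ S) = ∫⁻ x in S, f (tailArray n x) A ∂p := by
  refine measure_preimage_inter_eq_setLIntegral (entryAlgebra_le _) (measurable_rowTail n i)
    (measurable_tailArray_entryAlgebra fun k l => show n + k ≠ i by omega) hf
    isPiSystem_measurableCylinders generateFrom_measurableCylinders.symm (fun A hA => ?_) hA hS
  obtain ⟨I, B, -, rfl⟩ := (mem_measurableCylinders _).1 hA
  obtain ⟨σ, hσ, hσi, hσn⟩ := exists_injective_eq_self_or_ge {i} n
  obtain ⟨τ, hτ, hτI, hτn⟩ := exists_injective_eq_self_or_ge (I.image (n + ·)) n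
  refine ⟨_, hp.measurePreserving_reindex hσ hτ, measurable_to_entryAlgebra fun q hq => ?_, ?_⟩
  · refine measurable_entry_of_tailArray (comap_measurable (tailArray n))
      (hσn _ (by simpa using hq)) ?_
    by_cases h : q.2 ∈ I.image (n + ·)
    · rw [hτI _ h]
      obtain ⟨k, -, hk⟩ := Finset.mem_image.1 h
      omega
    · exact hτn _ h
  · ext x
    simp only [Set.mem_preimage, mem_cylinder]
    congr! 1
    ext k
    simp [rowTail, hσi i, hτI _ (Finset.mem_image_of_mem _ k.2)]

/-- The tail of column `j` depends on all other columns only through the tail array. -/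
theorem measure_colTail_preimage_inter (hp : RowColumnExchangeable p) {n j : ℕ}
    {g : Kernel (ℕ × ℕ → X) (ℕ → X)} [IsMarkovKernel g]
    (hg : p.map (fun x => (tailArray n x, colTail n j x)) = p.map (tailArray n) ⊗ₘ g)
    (hj : j < n) {A : Set (ℕ → X)} (hA : MeasurableSet A) {S : Set (ℕ × ℕ → X)}
    (hS : MeasurableSet[entryAlgebra X {q | q.2 ≠ j}] S) :
    p (colTail n j ⁻¹' A ∩ S) = ∫⁻ x in S, g (tailArray n x) A ∂p := by
  refine measure_preimage_inter_eq_setLIntegral (entryAlgebra_le _) (measurable_colTail n j)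
    (measurable_tailArray_entryAlgebra fun k l => show n + l ≠ j by omega) hg
    isPiSystem_measurableCylinders generateFrom_measurableCylinders.symm (fun A hA => ?_) hA hS
  obtain ⟨I, B, -, rfl⟩ := (mem_measurableCylinders _).1 hA
  obtain ⟨σ, hσ, hσI, hσn⟩ := exists_injective_eq_self_or_ge (I.image (n + ·)) n
  obtain ⟨τ, hτ, hτj, hτn⟩ := exists_injective_eq_self_or_ge {j} n
  refine ⟨_, hp.measurePreserving_reindex hσ hτ, measurable_to_entryAlgebra fun q hq => ?_, ?_⟩
  · refine measurable_entry_of_tailArray (comap_measurable (tailArray n)) ?_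
      (hτn _ (by simpa using hq))
    by_cases h : q.1 ∈ I.image (n + ·)
    · rw [hσI _ h]
      obtain ⟨k, -, hk⟩ := Finset.mem_image.1 h
      omega
    · exact hσn _ h
  · ext x
    simp only [Set.mem_preimage, mem_cylinder]
    congr! 1
    ext k
    simp [colTail, hτj j, hσI _ (Finset.mem_image_of_mem _ k.2)]

/-- The core entry `(i, j)` depends on all other entries only through the tail of row `i`, the
tail of column `j` and the tail array. -/
theorem measure_entry_preimage_inter (hp : RowColumnExchangeable p) {n i j : ℕ}
    {h : Kernel ((ℕ → X) × (ℕ × ℕ → X) × (ℕ → X)) X} [IsMarkovKernel h]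
    (hh : p.map (fun x => ((rowTail n i x, tailArray n x, colTail n j x), x (i, j)))
      = p.map (fun x => (rowTail n i x, tailArray n x, colTail n j x)) ⊗ₘ h)
    (hi : i < n) (hj : j < n) {A : Set X} (hA : MeasurableSet A) {S : Set (ℕ × ℕ → X)}
    (hS : MeasurableSet[entryAlgebra X {(i, j)}ᶜ] S) :
    p ((fun x => x (i, j)) ⁻¹' A ∩ S)
      = ∫⁻ x in S, h (rowTail n i x, tailArray n x, colTail n j x) A ∂p := by
  refine measure_preimage_inter_eq_setLIntegral (entryAlgebra_le _) (measurable_pi_apply _)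
    (Measurable.prodMk (measurable_rowTail_entryAlgebra fun k => ?_)
      (Measurable.prodMk (measurable_tailArray_entryAlgebra fun k l => ?_)
      (measurable_colTail_entryAlgebra fun k => ?_))) hh
    MeasurableSpace.isPiSystem_measurableSet MeasurableSpace.generateFrom_measurableSet.symm
    (fun A _ => ?_) hA hS
  · simp; omega
  · simp; omega
  · simp; omega
  obtain ⟨σ, hσ, hσi, hσn⟩ := exists_injective_eq_self_or_ge {i} n
  obtain ⟨τ, hτ, hτj, hτn⟩ := exists_injective_eq_self_or_ge {j} n
  refine ⟨_, hp.measurePreserving_reindex hσ hτ, measurable_to_entryAlgebra fun q hq => ?_, ?_⟩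
  · have hm := comap_measurable (m := Prod.instMeasurableSpace)
      fun x : ℕ × ℕ → X => (rowTail n i x, tailArray n x, colTail n j x)
    by_cases h1 : q.1 = i
    · have h2 : q.2 ≠ j := fun h2 => hq (Prod.ext h1 h2)
      rw [h1, hσi i (by simp)]
      exact measurable_entry_of_rowTail hm.fst (hτn _ (by simpa using h2))
    · by_cases h2 : q.2 = j
      · rw [h2, hτj j (by simp)]
        exact measurable_entry_of_colTail hm.snd.snd (hσn _ (by simpa using h1))
      · exact measurable_entry_of_tailArray hm.snd.fst (hσn _ (by simpa using h1))
          (hτn _ (by simpa using h2))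
  · ext x
    simp [hσi i, hτj j]

end RowColumnExchangeable

end Arrays

theorem measurable_map_prodMk {E F : Type*} [MeasurableSpace E] [MeasurableSpace F]
    (K : Kernel E F) [IsMarkovKernel K] :
    Measurable fun z => (K z).map fun y => (y, z) := by
  refine Measure.measurable_of_measurable_coe _ fun s hs => ?_
  simp only [Measure.map_apply measurable_prodMk_right hs]
  exact Kernel.measurable_kernel_prodMk_left (κ := K) (measurable_swap hs)

/-- **Aldous–Hoover Theorem (strong form)**: let `p` be a row-column exchangeable
probability measure on `ℕ × ℕ → X` (`X` standard Borel) and fix `n`.  Then there are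
Markov kernels `f, g : (ℕ × ℕ → X) → (ℕ → X)` and
`h : (ℕ → X) × (ℕ × ℕ → X) × (ℕ → X) → X` such that the pushforward of `p` under the
reorganization map `Φₙ` is the law of the quadruple generated as follows: sample `t ∼ p`;
sample `r i ∼ f t` independently for `i < n` and `c j ∼ g t` independently for `j < n`;
then, conditionally independently over all pairs `(i, j)` with `i, j < n`, sample the core
entry at `(i, j)` from `h (r i, t, c j)`; and output `(core, r, c, t)`. -/
theorem aldousHoover_strong {X : Type*} [MeasurableSpace X] [StandardBorelSpace X]
    (p : Measure (ℕ × ℕ → X)) [IsProbabilityMeasure p]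
    (hp : RowColumnExchangeable p) (n : ℕ) :
    ∃ (f g : Kernel (ℕ × ℕ → X) (ℕ → X))
      (h : Kernel ((ℕ → X) × (ℕ × ℕ → X) × (ℕ → X)) X),
      IsMarkovKernel f ∧ IsMarkovKernel g ∧ IsMarkovKernel h ∧
        p.map (reorganize n) =
          p.bind (fun t =>
            ((Measure.pi fun _ : Fin n => f t).prod (Measure.pi fun _ : Fin n => g t)).bind
              (fun rc =>
                (Measure.pi fun ij : Fin n × Fin n => h (rc.1 ij.1, t, rc.2 ij.2)).map
                  (fun core => (core, rc.1, rc.2, t)))) := by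
  have : Nonempty (ℕ × ℕ → X) := p.nonempty_of_neZero
  have : Nonempty X := this.map fun x => x (0, 0)
  let f := condDistrib (rowTail n 0) (tailArray n) p
  let g := condDistrib (colTail n 0) (tailArray n) p
  let h := condDistrib (fun x => x (0, 0))
    (fun x => (rowTail n 0 x, tailArray n x, colTail n 0 x)) p
  have hf : ∀ i : Fin n, p.map (fun x => (tailArray n x, rowTail n i x))
      = p.map (tailArray n) ⊗ₘ f := fun i => by
    rw [hp.map_tailArray_rowTail i.2, compProd_map_condDistrib (by fun_prop)]
  have hg : ∀ j : Fin n, p.map (fun x => (tailArray n x, colTail n j x))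
      = p.map (tailArray n) ⊗ₘ g := fun j => by
    rw [hp.map_tailArray_colTail j.2, compProd_map_condDistrib (by fun_prop)]
  have hmarg : ∀ i j : Fin n, p.map (fun x => (rowTail n i x, tailArray n x, colTail n j x))
      = p.map (fun x => (rowTail n 0 x, tailArray n x, colTail n 0 x)) := fun i j => by
    have := congrArg (Measure.map Prod.fst) (hp.map_tails_entry i.2 j.2)
    rwa [Measure.map_map measurable_fst (by fun_prop),
      Measure.map_map measurable_fst (by fun_prop)] at this
  have hh : ∀ i j : Fin n,
      p.map (fun x => ((rowTail n i x, tailArray n x, colTail n j x), x (i, j)))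
        = p.map (fun x => (rowTail n i x, tailArray n x, colTail n j x)) ⊗ₘ h := fun i j => by
    rw [hp.map_tails_entry i.2 j.2, hmarg,
      compProd_map_condDistrib (measurable_pi_apply _).aemeasurable]
  refine ⟨f, g, h, inferInstance, inferInstance, inferInstance, ?_⟩
  let Kf := piKernel fun _ : Fin n => f
  let Kg := piKernel fun _ : Fin n => g
  let proj : Fin n × Fin n → ((Fin n → ℕ → X) × (Fin n → ℕ → X) × (ℕ × ℕ → X)) →
      (ℕ → X) × (ℕ × ℕ → X) × (ℕ → X) := fun ij z => (z.1 ij.1, z.2.2, z.2.1 ij.2)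
  have hproj : ∀ ij, Measurable (proj ij) := fun ij => by fun_prop
  let Kh := piKernel fun ij => h.comap (proj ij) (hproj ij)
  let L := fun z => (Kh z).map fun core => (core, z)
  have hL : Measurable L := measurable_map_prodMk Kh
  have hLrc : ∀ t, Measurable fun rc : (Fin n → ℕ → X) × (Fin n → ℕ → X) =>
      L (rc.1, rc.2, t) := fun t => hL.comp (by fun_prop)
  let ρ : Kernel (ℕ × ℕ → X) ((Fin n → ℕ → X) × (Fin n → ℕ → X)) := Kf ×ₖ Kg
  have hρ : ∀ t, ρ t = (Kf t).prod (Kg t) := fun t => Kernel.prod_apply _ _ _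
  have hbind : Measurable fun t => (ρ t).bind fun rc => L (rc.1, rc.2, t) := by
    refine Measure.measurable_of_measurable_coe _ fun s hs => ?_
    simp only [Measure.bind_apply hs (hLrc _).aemeasurable]
    exact Measurable.lintegral_kernel_prod_right'
      (f := fun q : (ℕ × ℕ → X) × (Fin n → ℕ → X) × (Fin n → ℕ → X) =>
        L (q.2.1, q.2.2, q.1) s)
      ((Measure.measurable_coe hs).comp (hL.comp (by fun_prop)))
  let row := fun (x : ℕ × ℕ → X) (i : Fin n) => rowTail n i x
  let col := fun (x : ℕ × ℕ → X) (j : Fin n) => colTail n j x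
  have hcol : Measurable col := by fun_prop
  have hΦ : Measurable (reorganize (X := X) n) := by
    unfold reorganize
    fun_prop
  have core_law : ∀ s, MeasurableSet s →
      p.map (reorganize n) s = ∫⁻ x, L (row x, col x, tailArray n x) s ∂p := by
    intro s hs
    rw [Measure.map_apply hΦ hs, ← lintegral_indicator_one (hΦ hs)]
    refine (lintegral_eq_lintegral_piKernel
      (mW := fun ij : Fin n × Fin n => entryAlgebra X {((ij.1 : ℕ), (ij.2 : ℕ))}ᶜ)
      (Z := fun x => (row x, col x, tailArray n x)) (Y := fun ij x => x (ij.1, ij.2))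
      (G := fun q => s.indicator 1 (q.2, q.1)) (fun _ => entryAlgebra_le _)
      (by fun_prop) (fun _ => measurable_pi_apply _) (fun ij => ?_) (fun ij kl hne => ?_)
      (fun ij => h.comap (proj ij) (hproj ij)) (fun ij A hA S hS => ?_)
      ((measurable_one.indicator hs).comp measurable_swap)).trans (lintegral_congr fun x => ?_)
    · refine (@measurable_pi_lambda _ _ _ (entryAlgebra X _) _ _ fun i =>
        measurable_rowTail_entryAlgebra fun k => ?_).prodMk
        ((@measurable_pi_lambda _ _ _ (entryAlgebra X _) _ _ fun j =>
          measurable_colTail_entryAlgebra fun k => ?_).prodMk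
        (measurable_tailArray_entryAlgebra fun k l => ?_)) <;> simp <;> omega
    · refine measurable_entry ?_
      contrapose! hne
      simpa [Prod.ext_iff, Fin.ext_iff] using hne
    · exact hp.measure_entry_preimage_inter (hh ij.1 ij.2) ij.1.2 ij.2.2 hA hS
    · rw [Measure.map_apply measurable_prodMk_right hs,
        ← lintegral_indicator_one (measurable_prodMk_right hs)]
      rfl
  have row_law : ∀ s, MeasurableSet s → ∫⁻ x, L (row x, col x, tailArray n x) s ∂p
      = ∫⁻ x, ∫⁻ r, L (r, col x, tailArray n x) s ∂(Kf (tailArray n x)) ∂p := by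
    intro s hs
    refine lintegral_eq_lintegral_piKernel
      (mW := fun i : Fin n => entryAlgebra X {q | q.1 ≠ i})
      (Z := fun x => (col x, tailArray n x)) (Y := fun i x => rowTail n i x)
      (G := fun q => L (q.2, q.1) s) (fun _ => entryAlgebra_le _)
      (by fun_prop) (fun _ => measurable_rowTail _ _) (fun i => ?_) (fun i k hne => ?_)
      (fun _ => f.comap Prod.snd measurable_snd) (fun i A hA S hS => ?_)
      ((Measure.measurable_coe hs).comp (hL.comp measurable_swap))
    · refine (@measurable_pi_lambda _ _ _ (entryAlgebra X _) _ _ fun j =>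
          measurable_colTail_entryAlgebra fun k => ?_).prodMk
        (measurable_tailArray_entryAlgebra fun k l => ?_) <;> simp <;> omega
    · exact measurable_rowTail_entryAlgebra fun _ => Fin.val_ne_of_ne hne
    · exact hp.measure_rowTail_preimage_inter (hf i) i.2 hA hS
  have col_law : ∀ s, MeasurableSet s →
      ∫⁻ x, ∫⁻ r, L (r, col x, tailArray n x) s ∂(Kf (tailArray n x)) ∂p
        = ∫⁻ x, ∫⁻ c, ∫⁻ r, L (r, c, tailArray n x) s ∂(Kf (tailArray n x))
          ∂(Kg (tailArray n x)) ∂p := by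
    intro s hs
    refine lintegral_eq_lintegral_piKernel
      (mW := fun j : Fin n => entryAlgebra X {q | q.2 ≠ j})
      (Z := tailArray n) (Y := fun j x => colTail n j x)
      (G := fun q => ∫⁻ r, L (r, q.2, q.1) s ∂(Kf q.1)) (fun _ => entryAlgebra_le _)
      (by fun_prop) (fun _ => measurable_colTail _ _) (fun j => ?_) (fun j k hne => ?_)
      (fun _ => g) (fun j A hA S hS => ?_) ?_
    · exact measurable_tailArray_entryAlgebra fun k l => by simp; omega
    · exact measurable_colTail_entryAlgebra fun _ => Fin.val_ne_of_ne hne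
    · exact hp.measure_colTail_preimage_inter (hg j) j.2 hA hS
    · exact Measurable.lintegral_kernel_prod_right' (κ := Kf.comap Prod.fst measurable_fst)
        (f := fun q : ((ℕ × ℕ → X) × (Fin n → ℕ → X)) × (Fin n → ℕ → X) =>
          L (q.2, q.1.2, q.1.1) s)
        ((Measure.measurable_coe hs).comp (hL.comp (by fun_prop)))
  change _ = p.bind fun t => ((Kf t).prod (Kg t)).bind fun rc => L (rc.1, rc.2, t)
  simp only [← hρ]
  refine Measure.ext fun s hs => ?_
  have hbs : Measurable fun t => (ρ t).bind (fun rc => L (rc.1, rc.2, t)) s :=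
    (Measure.measurable_coe hs).comp hbind
  rw [core_law s hs, row_law s hs, col_law s hs, Measure.bind_apply hs hbind.aemeasurable]
  conv_rhs => rw [← (hp.measurePreserving_tailArray n).map_eq]
  rw [lintegral_map hbs (measurable_tailArray n)]
  refine lintegral_congr fun x => ?_
  rw [Measure.bind_apply hs (hLrc _).aemeasurable, hρ, lintegral_prod_symm]
  exact ((Measure.measurable_coe hs).comp (hLrc _)).aemeasurable
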